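/- Non-recoverability under a collider path (instance of Theorem 3, second condition): there exist two probability measures P₁ and P₂ on Bool × Bool × Bool (coordinates interpreted as a partially observed variable X, a fully observed variable W, and the missingness indicator R_X of X), both of which make X independent of R_X, such that the pushforwards of P₁ and P₂ under the masking map (x, w, r) ↦ ((if r = 0 then some x else none), w, r) into Option Bool × Bool × Bool are equal and assign positive probability to every point consistent with the masking, yet P₁(X = true | W = true) ≠ P₂(X = true | W = true). Consequently P(X|W) is not recoverable even though X ⟂ R_X holds. -/

import Mathlib

open MeasureTheory

/-- Elementary conditional probability `P(A | B)`. -/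
noncomputable def cpr {Ω : Type*} [MeasurableSpace Ω] (P : Measure Ω) (A B : Set Ω) : ENNReal :=
  P (A ∩ B) / P B

/-- Discrete σ-algebra on `Option α`. -/
instance {α : Type*} : MeasurableSpace (Option α) := ⊤

/-- The masking map `(x, w, r) ↦ ((if r = 0 then some x else none), w, r)`; `r = false`
means observed (`R = 0`), `r = true` means missing (`R = 1`). -/
def mask {α β : Type*} (p : α × β × Bool) : Option α × β × Bool :=
  ((if p.2.2 = false then some p.1 else none), p.2.1, p.2.2)

open scoped NNReal

/-- The point masses of `twoLayerLaw`. -/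
noncomputable def twoLayerMass (a b : ℝ≥0) (p : Bool × Bool × Bool) : ℝ≥0 :=
  if p.2.2 = false then 8⁻¹ else if p.1 = p.2.1 then a else b

/-- A law of `(X, W, R)` that is uniform on the layer `R = 0`; on the layer `R = 1` the points
with `X = W` have mass `a` and the points with `X ≠ W` have mass `b`. -/
noncomputable def twoLayerLaw (a b : ℝ≥0) : Measure (Bool × Bool × Bool) :=
  ∑ p, twoLayerMass a b p • Measure.dirac p

open Classical in
lemma twoLayerLaw_apply (a b : ℝ≥0) (s : Set (Bool × Bool × Bool)) :
    twoLayerLaw a b s = ((∑ p, if p ∈ s then twoLayerMass a b p else 0 : ℝ≥0) : ENNReal) := by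
  simp only [twoLayerLaw, Measure.finsetSum_apply, ENNReal.ofNNReal_finsetSum]
  refine Finset.sum_congr rfl fun p _ => ?_
  rw [Measure.smul_apply, Measure.dirac_apply, ENNReal.smul_def, smul_eq_mul]
  by_cases hp : p ∈ s <;> simp [hp]

lemma isProbabilityMeasure_twoLayerLaw {a b : ℝ≥0} (h : a + b = 4⁻¹) :
    IsProbabilityMeasure (twoLayerLaw a b) := by
  have h' : (a : ℝ) + b = 4⁻¹ := by simpa using congrArg NNReal.toReal h
  constructor
  rw [twoLayerLaw_apply, ENNReal.coe_eq_one, ← NNReal.coe_inj]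
  simp [Fintype.sum_prod_type, twoLayerMass]
  linarith

lemma twoLayerLaw_indep {a b : ℝ≥0} (h : a + b = 4⁻¹) (x r : Bool) :
    twoLayerLaw a b {p | p.1 = x ∧ p.2.2 = r} =
      twoLayerLaw a b {p | p.1 = x} * twoLayerLaw a b {p | p.2.2 = r} := by
  have h' : (b : ℝ) = 4⁻¹ - a := by
    simpa [eq_sub_iff_add_eq'] using congrArg NNReal.toReal h
  simp only [twoLayerLaw_apply]
  rw [← ENNReal.coe_mul, ENNReal.coe_inj, ← NNReal.coe_inj]
  cases x <;> cases r <;> simp [Fintype.sum_prod_type, twoLayerMass, h'] <;> ring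

lemma map_mask_twoLayerLaw_apply (a b : ℝ≥0) (s : Set (Option Bool × Bool × Bool)) :
    (twoLayerLaw a b).map mask s = twoLayerLaw a b (mask ⁻¹' s) := by
  have : DiscreteMeasurableSpace (Option Bool) := ⟨fun _ => trivial⟩
  exact Measure.map_apply .of_discrete .of_discrete

open Classical in
lemma map_mask_twoLayerLaw_congr {a b c d : ℝ≥0} (h : a + b = c + d) :
    (twoLayerLaw a b).map mask = (twoLayerLaw c d).map mask := by
  have h' : (b : ℝ) = c + d - a := by rw [eq_sub_iff_add_eq']; exact_mod_cast h
  ext s -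
  have hsum (a b : ℝ≥0) : (twoLayerLaw a b).map mask s =
      ((∑ p, if mask p ∈ s then twoLayerMass a b p else 0 : ℝ≥0) : ENNReal) := by
    rw [map_mask_twoLayerLaw_apply, twoLayerLaw_apply]
    rfl
  rw [hsum, hsum, ENNReal.coe_inj, ← NNReal.coe_inj]
  simp only [Fintype.sum_prod_type, Fintype.sum_bool, mask, twoLayerMass]
  by_cases h₁ : (none, true, true) ∈ s <;> by_cases h₂ : (none, false, true) ∈ s <;>
    simp [h₁, h₂, h'] <;> ring

lemma twoLayerLaw_pos {a b : ℝ≥0} (ha : 0 < a) (hb : 0 < b) {s : Set (Bool × Bool × Bool)}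
    (hs : s.Nonempty) : 0 < twoLayerLaw a b s := by
  obtain ⟨p, hp⟩ := hs
  rw [twoLayerLaw_apply, ENNReal.coe_pos]
  refine Finset.sum_pos' (fun _ _ => zero_le) ⟨p, Finset.mem_univ p, ?_⟩
  rw [if_pos hp, twoLayerMass]
  split_ifs <;> first | assumption | positivity

lemma cpr_twoLayerLaw {a b : ℝ≥0} (h : a + b = 4⁻¹) :
    cpr (twoLayerLaw a b) {p | p.1 = true} {p | p.2.1 = true} =
      ((4⁻¹ + 2 * a : ℝ≥0) : ENNReal) := by
  have h' : (b : ℝ) = 4⁻¹ - a := by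
    simpa [eq_sub_iff_add_eq'] using congrArg NNReal.toReal h
  have hW : twoLayerLaw a b {p | p.2.1 = true} = ((2⁻¹ : ℝ≥0) : ENNReal) := by
    rw [twoLayerLaw_apply, ENNReal.coe_inj, ← NNReal.coe_inj]
    simp [Fintype.sum_prod_type, twoLayerMass, h']
    ring
  rw [cpr, hW, twoLayerLaw_apply, ← ENNReal.coe_div (by simp), ENNReal.coe_inj, ← NNReal.coe_inj]
  simp [Fintype.sum_prod_type, twoLayerMass]
  ring

/-- **Non-recoverability under a collider path (instance of Theorem 3, second condition).**
There exist two probability measures on `Bool × Bool × Bool` (coordinates: a partially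
observed `X`, a fully observed `W`, and the indicator `R_X`), both making `X ⟂ R_X`,
whose masked (observed-data) distributions coincide and put positive mass on every point
consistent with the masking, while `P₁(X = true | W = true) ≠ P₂(X = true | W = true)`.
Hence `P(X|W)` is not recoverable even though `X ⟂ R_X`. -/
theorem collider_path_non_recoverable :
    ∃ (P₁ P₂ : Measure (Bool × Bool × Bool)),
      IsProbabilityMeasure P₁ ∧ IsProbabilityMeasure P₂ ∧
      -- X is independent of R_X under P₁ and under P₂:
      (∀ (x r : Bool),
        P₁ {p | p.1 = x ∧ p.2.2 = r} = P₁ {p | p.1 = x} * P₁ {p | p.2.2 = r}) ∧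
      (∀ (x r : Bool),
        P₂ {p | p.1 = x ∧ p.2.2 = r} = P₂ {p | p.1 = x} * P₂ {p | p.2.2 = r}) ∧
      -- equal observed-data distributions:
      P₁.map mask = P₂.map mask ∧
      -- positive probability on every point consistent with the masking:
      (∀ (x w : Bool), 0 < P₁.map mask {((some x : Option Bool), w, false)}) ∧
      (∀ w : Bool, 0 < P₁.map mask {((none : Option Bool), w, true)}) ∧
      -- yet the conditional distributions P(X = true | W = true) differ:
      cpr P₁ {p | p.1 = true} {p | p.2.1 = true} ≠
        cpr P₂ {p | p.1 = true} {p | p.2.1 = true} := by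
  have h₁ : (8⁻¹ + 8⁻¹ : ℝ≥0) = 4⁻¹ := by rw [← NNReal.coe_inj]; norm_num
  have h₂ : (3 / 16 + 1 / 16 : ℝ≥0) = 4⁻¹ := by rw [← NNReal.coe_inj]; norm_num
  refine ⟨twoLayerLaw 8⁻¹ 8⁻¹, twoLayerLaw (3 / 16) (1 / 16),
    isProbabilityMeasure_twoLayerLaw h₁, isProbabilityMeasure_twoLayerLaw h₂,
    twoLayerLaw_indep h₁, twoLayerLaw_indep h₂, map_mask_twoLayerLaw_congr (h₁.trans h₂.symm),
    fun x w => ?_, fun w => ?_, ?_⟩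
  · rw [map_mask_twoLayerLaw_apply]
    exact twoLayerLaw_pos (by positivity) (by positivity) ⟨(x, w, false), by simp [mask]⟩
  · rw [map_mask_twoLayerLaw_apply]
    exact twoLayerLaw_pos (by positivity) (by positivity) ⟨(true, w, true), by simp [mask]⟩
  · rw [cpr_twoLayerLaw h₁, cpr_twoLayerLaw h₂, Ne, ENNReal.coe_inj, ← NNReal.coe_inj]
    norm_num
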